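/- arXiv:2103.13327 — 9 statements merged into one kernel-verified Lean document; each statement's English description precedes it below -/
import Mathlib

section
/- Let α ∈ ℝ and let Y : ℝ → ℝ^{n×p} be a twice-differentiable curve with Y(t)ᵀY(t) = I_p for all t that satisfies the α-geodesic equation. Then the function t ↦ Y(t)ᵀY'(t) is constant; in particular Y(t)ᵀY'(t) = Y(0)ᵀY'(0) for all t. -/
open Matrix NormedSpace
attribute [local instance] Matrix.normedAddCommGroup Matrix.normedSpace

/-- A twice-differentiable curve `Y : ℝ → ℝ^{n×p}` satisfies the α-geodesic equation if
`Y'' + Y (Y'ᵀ Y') + 2(1−α)(I − Y Yᵀ)(Y' Y'ᵀ) Y = 0`. -/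
def IsAlphaGeodesic {n p : ℕ} (α : ℝ) (Y : ℝ → Matrix (Fin n) (Fin p) ℝ) : Prop :=
  (∀ t, DifferentiableAt ℝ Y t) ∧ (∀ t, DifferentiableAt ℝ (deriv Y) t) ∧
  ∀ t : ℝ, deriv (deriv Y) t + Y t * ((deriv Y t)ᵀ * deriv Y t)
    + (2 * (1 - α)) • (((1 : Matrix (Fin n) (Fin n) ℝ) - Y t * (Y t)ᵀ)
        * (deriv Y t * (deriv Y t)ᵀ) * Y t) = 0

/-- Along any α-geodesic on the Stiefel manifold, `A(t) = Y(t)ᵀ Y'(t)` is constant. -/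
theorem stiefel_geodesic_A_constant {n p : ℕ} (α : ℝ)
    (Y : ℝ → Matrix (Fin n) (Fin p) ℝ)
    (hSt : ∀ t : ℝ, (Y t)ᵀ * Y t = 1)
    (hgeo : IsAlphaGeodesic α Y) :
    ∀ t : ℝ, (Y t)ᵀ * deriv Y t = (Y 0)ᵀ * deriv Y 0 := by
  obtain ⟨h1, h2, h3⟩ := hgeo
  have key : ∀ t, (deriv Y t)ᵀ * deriv Y t + (Y t)ᵀ * deriv (deriv Y) t = 0 := by
    intro t
    have h := congrArg (fun M => (Y t)ᵀ * M) (h3 t)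
    have hz : (Y t)ᵀ * ((1 : Matrix (Fin n) (Fin n) ℝ) - Y t * (Y t)ᵀ) = 0 := by
      rw [Matrix.mul_sub, ← Matrix.mul_assoc, hSt t]; simp
    simp only [Matrix.mul_add, Matrix.mul_smul, ← Matrix.mul_assoc, Matrix.mul_zero] at h hz
    simp only [hSt t, hz, Matrix.zero_mul, smul_zero, add_zero, Matrix.one_mul] at h
    rw [add_comm]; exact h
  have e1 : ∀ t i j, HasDerivAt (fun s => Y s i j) (deriv Y t i j) t := by
    intro t i j
    exact hasDerivAt_pi.1 (hasDerivAt_pi.1 (h1 t).hasDerivAt i) j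
  have e2 : ∀ t i j, HasDerivAt (fun s => deriv Y s i j) (deriv (deriv Y) t i j) t := by
    intro t i j
    exact hasDerivAt_pi.1 (hasDerivAt_pi.1 (h2 t).hasDerivAt i) j
  intro t
  ext i j
  have hd : ∀ s, HasDerivAt (fun s => ((Y s)ᵀ * deriv Y s) i j) 0 s := by
    intro s
    have hs := HasDerivAt.fun_sum (u := Finset.univ)
      (fun k _ => (e1 s k i).fun_mul (e2 s k j))
    have hk := congrFun (congrFun (key s) i) j
    simp only [Matrix.add_apply, Matrix.mul_apply, Matrix.transpose_apply, Matrix.zero_apply,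
      ← Finset.sum_add_distrib] at hk
    rw [hk] at hs
    simpa only [Matrix.mul_apply, Matrix.transpose_apply] using hs
  exact is_const_of_deriv_eq_zero (fun s => (hd s).differentiableAt) (fun s => (hd s).deriv) t 0
end

section
/- Let α ∈ ℝ, let Ỹ ∈ ℝ^{n×p} satisfy ỸᵀỸ = I_p, and let η ∈ ℝ^{n×p} satisfy Ỹᵀη = 0 (a horizontal vector). Set S := ηᵀη and define Y(t) := Ỹ·csr(t²S) + t·η·ssr(t²S). Then Y(0) = Ỹ, Y'(0) = η, Y(t)ᵀY(t) = I_p for all t ∈ ℝ, and Y satisfies the α-geodesic equation (for every value of α). -/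
open Matrix

attribute [local instance] Matrix.normedAddCommGroup Matrix.normedSpace

/-- The entire matrix function `csr(X) = ∑ (−1)^m X^m/(2m)!`, so `csr(x²) = cos x`. -/
noncomputable def csr {p : ℕ} (X : Matrix (Fin p) (Fin p) ℝ) : Matrix (Fin p) (Fin p) ℝ :=
  ∑' m : ℕ, ((-1 : ℝ) ^ m / (Nat.factorial (2 * m) : ℝ)) • X ^ m

/-- The entire matrix function `ssr(X) = ∑ (−1)^m X^m/(2m+1)!`, so `x · ssr(x²) = sin x`. -/
noncomputable def ssr {p : ℕ} (X : Matrix (Fin p) (Fin p) ℝ) : Matrix (Fin p) (Fin p) ℝ :=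
  ∑' m : ℕ, ((-1 : ℝ) ^ m / (Nat.factorial (2 * m + 1) : ℝ)) • X ^ m

lemma aux_hasDerivAt_mul {n p q : ℕ} (A : Matrix (Fin n) (Fin p) ℝ)
    {F : ℝ → Matrix (Fin p) (Fin q) ℝ} {F' : Matrix (Fin p) (Fin q) ℝ} {t : ℝ}
    (h : HasDerivAt F F' t) : HasDerivAt (fun s => A * F s) (A * F') t := by
  refine hasDerivAt_pi.2 fun i => hasDerivAt_pi.2 fun j => ?_
  simp only [Matrix.mul_apply]
  refine HasDerivAt.fun_sum fun k _ => ?_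
  exact ((hasDerivAt_pi.1 (hasDerivAt_pi.1 h k) j)).const_mul (A i k)

lemma aux_hasDerivAt_mul_right {n p q : ℕ} (A : Matrix (Fin p) (Fin q) ℝ)
    {F : ℝ → Matrix (Fin n) (Fin p) ℝ} {F' : Matrix (Fin n) (Fin p) ℝ} {t : ℝ}
    (h : HasDerivAt F F' t) : HasDerivAt (fun s => F s * A) (F' * A) t := by
  refine hasDerivAt_pi.2 fun i => hasDerivAt_pi.2 fun j => ?_
  simp only [Matrix.mul_apply]
  refine HasDerivAt.fun_sum fun k _ => ?_
  exact ((hasDerivAt_pi.1 (hasDerivAt_pi.1 h i) k)).mul_const (A k j)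

lemma aux_hasDerivAt_diagonal {p : ℕ}
    {f : ℝ → Fin p → ℝ} {f' : Fin p → ℝ} {t : ℝ}
    (h : ∀ i, HasDerivAt (fun s => f s i) (f' i) t) :
    HasDerivAt (fun s => Matrix.diagonal (f s)) (Matrix.diagonal f') t := by
  refine hasDerivAt_pi.2 fun i => hasDerivAt_pi.2 fun j => ?_
  by_cases hij : i = j
  · subst hij; simpa using h i
  · simpa [Matrix.diagonal_apply_ne _ hij] using hasDerivAt_const t (0:ℝ)

/-- scalar `t * ssr(t^2 r^2)` -/
noncomputable def auxSin (r t : ℝ) : ℝ := if r = 0 then t else Real.sin (t * r) / r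

/-- scalar `ssr(x^2)` -/
noncomputable def auxSinc (x : ℝ) : ℝ := if x = 0 then 1 else Real.sin x / x

lemma auxSin_deriv (r t : ℝ) : HasDerivAt (auxSin r) (Real.cos (t * r)) t := by
  unfold auxSin
  by_cases hr : r = 0
  · subst hr; simpa using hasDerivAt_id' t
  · simp only [hr, if_false]
    have := (((hasDerivAt_id' t).mul_const r).sin).div_const r
    simpa [hr] using this

lemma auxCos_deriv (r t : ℝ) :
    HasDerivAt (fun s => Real.cos (s * r)) (-(r ^ 2 * auxSin r t)) t := by
  have := (((hasDerivAt_id' t).mul_const r).cos)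
  convert this using 1
  unfold auxSin
  split_ifs with hr
  · simp [hr]
  · simp; field_simp

lemma aux_sq (r t : ℝ) :
    Real.cos (t * r) * Real.cos (t * r) + r ^ 2 * (auxSin r t * auxSin r t) = 1 := by
  unfold auxSin
  split_ifs with hr
  · simp [hr]
  · field_simp; linarith [Real.sin_sq_add_cos_sq (t * r)]

lemma auxSin_eq (r t : ℝ) : t * auxSinc (t * r) = auxSin r t := by
  unfold auxSin auxSinc
  by_cases hr : r = 0
  · simp [hr]
  · by_cases ht : t = 0
    · simp [ht]
    · simp [hr, ht]; field_simp

lemma aux_hasSum_sinc (x : ℝ) :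
    HasSum (fun m : ℕ => ((-1 : ℝ) ^ m / (Nat.factorial (2 * m + 1) : ℝ)) * (x ^ 2) ^ m)
      (auxSinc x) := by
  unfold auxSinc
  split_ifs with hx
  · subst hx
    convert hasSum_single (f := fun m : ℕ =>
      ((-1 : ℝ) ^ m / (Nat.factorial (2 * m + 1) : ℝ)) * ((0:ℝ) ^ 2) ^ m) 0 ?_ using 1
    · simp
    · intro m hm; simp [hm]
  · have h := (Real.hasSum_sin x).div_const x
    refine (congrArg (fun f => HasSum f (Real.sin x / x)) ?_).mpr h
    funext m
    rw [← pow_mul, pow_succ]; field_simp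

lemma aux_hasSum_cos (x : ℝ) :
    HasSum (fun m : ℕ => ((-1 : ℝ) ^ m / (Nat.factorial (2 * m) : ℝ)) * (x ^ 2) ^ m)
      (Real.cos x) := by
  convert Real.hasSum_cos x using 2 with m
  rw [← pow_mul]; ring

lemma aux_series {p : ℕ} (U V : Matrix (Fin p) (Fin p) ℝ) (hVU : V * U = 1) (hUV : U * V = 1)
    (d g : Fin p → ℝ) (a : ℕ → ℝ) (h : ∀ i, HasSum (fun m => a m * (d i) ^ m) (g i)) :
    ∑' m : ℕ, a m • (U * Matrix.diagonal d * V) ^ m = U * Matrix.diagonal g * V := by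
  have hp : ∀ m : ℕ, (U * Matrix.diagonal d * V) ^ m = U * Matrix.diagonal (d ^ m) * V := by
    intro m
    induction m with
    | zero => simp [hUV]
    | succ k ih =>
      rw [pow_succ, ih]
      calc _ = U * Matrix.diagonal (d ^ k) * (V * U) * Matrix.diagonal d * V := by noncomm_ring
        _ = U * (Matrix.diagonal (d ^ k) * Matrix.diagonal d) * V := by
          rw [hVU]; noncomm_ring
        _ = _ := by
          rw [Matrix.diagonal_mul_diagonal]; rfl
  have h1 : HasSum (fun m : ℕ => Matrix.diagonal (fun i => a m * (d i) ^ m))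
      (Matrix.diagonal g) := HasSum.matrix_diagonal (Pi.hasSum.2 h)
  have h2 := (h1.mul_left U).mul_right V
  refine HasSum.tsum_eq ?_
  refine (congrArg (fun f => HasSum f (U * Matrix.diagonal g * V)) ?_).mpr h2
  funext m
  rw [hp]
  have : Matrix.diagonal (fun i => a m * (d i) ^ m) = a m • Matrix.diagonal (d ^ m) := by
    rw [← Matrix.diagonal_smul]; rfl
  rw [this]; simp

lemma aux_main {p : ℕ} (S : Matrix (Fin p) (Fin p) ℝ) (hS : S.PosSemidef) :
    ∃ C T : ℝ → Matrix (Fin p) (Fin p) ℝ,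
      (∀ t : ℝ, csr ((t ^ 2) • S) = C t) ∧ (∀ t : ℝ, t • ssr ((t ^ 2) • S) = T t) ∧
      (∀ t, HasDerivAt C (-(S * T t)) t) ∧ (∀ t, HasDerivAt T (C t) t) ∧
      (∀ t, (C t)ᵀ = C t) ∧ (∀ t, (T t)ᵀ = T t) ∧
      (∀ t, C t * S = S * C t) ∧ (∀ t, T t * S = S * T t) ∧ (∀ t, C t * T t = T t * C t) ∧
      (∀ t, C t * C t + S * (T t * T t) = 1) ∧ C 0 = 1 ∧ T 0 = 0 := by
  obtain ⟨U, r, hVU, hUV, hSd⟩ : ∃ (U : Matrix (Fin p) (Fin p) ℝ) (r : Fin p → ℝ),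
      Uᵀ * U = 1 ∧ U * Uᵀ = 1 ∧ S = U * Matrix.diagonal (fun i => r i ^ 2) * Uᵀ := by
    refine ⟨hS.1.eigenvectorUnitary, fun i => Real.sqrt (hS.1.eigenvalues i), ?_, ?_, ?_⟩
    · simpa [Matrix.star_eq_conjTranspose] using
        Unitary.coe_star_mul_self hS.1.eigenvectorUnitary
    · simpa [Matrix.star_eq_conjTranspose] using
        Unitary.coe_mul_star_self hS.1.eigenvectorUnitary
    · have h := hS.1.spectral_theorem
      rw [Unitary.conjStarAlgAut_apply] at h
      simp only [Real.sq_sqrt (hS.eigenvalues_nonneg _)]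
      simpa [Matrix.star_eq_conjTranspose, Function.comp_def] using h
  have hmul : ∀ f g : Fin p → ℝ, (U * Matrix.diagonal f * Uᵀ) * (U * Matrix.diagonal g * Uᵀ)
      = U * Matrix.diagonal (fun i => f i * g i) * Uᵀ := by
    intro f g
    rw [← Matrix.diagonal_mul_diagonal]
    calc _ = U * Matrix.diagonal f * (Uᵀ * U) * Matrix.diagonal g * Uᵀ := by noncomm_ring
      _ = _ := by rw [hVU]; noncomm_ring
  have htr : ∀ f : Fin p → ℝ, (U * Matrix.diagonal f * Uᵀ)ᵀ = U * Matrix.diagonal f * Uᵀ := by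
    intro f; simp [Matrix.mul_assoc]
  have hsm : ∀ t : ℝ, (t ^ 2) • S = U * Matrix.diagonal (fun i => (t * r i) ^ 2) * Uᵀ := by
    intro t
    have : Matrix.diagonal (fun i => (t * r i) ^ 2)
        = (t ^ 2) • Matrix.diagonal (fun i => (r i) ^ 2) := by
      rw [← Matrix.diagonal_smul]; congr 1; ext i; simp [mul_pow]
    rw [this, hSd]; simp
  refine ⟨fun t => U * Matrix.diagonal (fun i => Real.cos (t * r i)) * Uᵀ,
    fun t => U * Matrix.diagonal (fun i => auxSin (r i) t) * Uᵀ,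
    ?_, ?_, ?_, ?_, fun t => htr _, fun t => htr _, ?_, ?_, ?_, ?_, ?_, ?_⟩
  · intro t
    rw [hsm, csr]
    exact aux_series U Uᵀ hVU hUV _ _ _ fun i => aux_hasSum_cos (t * r i)
  · intro t
    rw [hsm, ssr, aux_series U Uᵀ hVU hUV _ _ _ fun i => aux_hasSum_sinc (t * r i)]
    have : Matrix.diagonal (fun i => auxSin (r i) t)
        = t • Matrix.diagonal (fun i => auxSinc (t * r i)) := by
      rw [← Matrix.diagonal_smul]; congr 1; ext i; simp [auxSin_eq]
    show _ = U * Matrix.diagonal (fun i => auxSin (r i) t) * Uᵀ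
    rw [this]; simp
  · intro t
    have : -(S * (U * Matrix.diagonal (fun i => auxSin (r i) t) * Uᵀ))
        = U * Matrix.diagonal (fun i => -(r i ^ 2 * auxSin (r i) t)) * Uᵀ := by
      rw [hSd, hmul, ← Matrix.neg_mul, ← Matrix.mul_neg, Matrix.diagonal_neg]
    rw [this]
    exact aux_hasDerivAt_mul_right _ (aux_hasDerivAt_mul _
      (aux_hasDerivAt_diagonal fun i => auxCos_deriv (r i) t))
  · intro t
    exact aux_hasDerivAt_mul_right _ (aux_hasDerivAt_mul _
      (aux_hasDerivAt_diagonal fun i => auxSin_deriv (r i) t))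
  · intro t; simp only [hSd, hmul, mul_comm]
  · intro t; simp only [hSd, hmul, mul_comm]
  · intro t; simp only [hmul, mul_comm]
  · intro t
    simp only [hSd, hmul]
    rw [← Matrix.add_mul, ← Matrix.mul_add, Matrix.diagonal_add]
    simp only [aux_sq]
    simp [hUV]
  · simp [hUV]
  · simp [auxSin]

/-- For a horizontal tangent vector `η` (`Ỹᵀη = 0`) with `S = ηᵀη`, the curve
`Y(t) = Ỹ csr(t²S) + t η ssr(t²S)` is the Stiefel geodesic with `Y(0)=Ỹ`, `Y'(0)=η`,
for every metric parameter α. -/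
theorem grassmann_horizontal_geodesic {n p : ℕ} (α : ℝ)
    (Ytilde η : Matrix (Fin n) (Fin p) ℝ)
    (hY : Ytildeᵀ * Ytilde = 1) (hhor : Ytildeᵀ * η = 0) :
    let S : Matrix (Fin p) (Fin p) ℝ := ηᵀ * η
    let Y : ℝ → Matrix (Fin n) (Fin p) ℝ := fun t =>
      Ytilde * csr ((t ^ 2) • S) + t • (η * ssr ((t ^ 2) • S))
    Y 0 = Ytilde ∧ deriv Y 0 = η ∧ (∀ t : ℝ, (Y t)ᵀ * Y t = 1) ∧ IsAlphaGeodesic α Y := by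
  intro S Y
  have hS : S.PosSemidef := by
    simpa [S] using Matrix.posSemidef_conjTranspose_mul_self η
  have hSdef : ηᵀ * η = S := rfl
  have hSt : Sᵀ = S := by simp [S]
  have hhor' : ηᵀ * Ytilde = 0 := by
    have := congrArg Matrix.transpose hhor
    simpa using this
  obtain ⟨C, T, hC, hT, hC', hT', hCt, hTt, hCS, hTS, hCT, h1, hC0, hT0⟩ := aux_main S hS
  have hYe : Y = fun t => Ytilde * C t + η * T t := by
    funext t
    simp only [Y, hC, ← hT, Matrix.mul_smul]
  clear_value Y S
  subst hYe
  have hprod : ∀ A B A' B' : Matrix (Fin p) (Fin p) ℝ,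
      (Ytilde * A + η * B)ᵀ * (Ytilde * A' + η * B') = Aᵀ * A' + Bᵀ * (S * B') := by
    intro A B A' B'
    have e1 : Ytildeᵀ * (Ytilde * A') = A' := by rw [← Matrix.mul_assoc, hY, Matrix.one_mul]
    have e2 : Ytildeᵀ * (η * B') = 0 := by rw [← Matrix.mul_assoc, hhor, Matrix.zero_mul]
    have e3 : ηᵀ * (Ytilde * A') = 0 := by rw [← Matrix.mul_assoc, hhor', Matrix.zero_mul]
    have e4 : ηᵀ * (η * B') = S * B' := by rw [← Matrix.mul_assoc, hSdef]
    simp only [Matrix.transpose_add, Matrix.transpose_mul, Matrix.add_mul, Matrix.mul_add,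
      Matrix.mul_assoc, e1, e2, e3, e4]
    simp
  have hd : ∀ t, HasDerivAt (fun t => Ytilde * C t + η * T t)
      (Ytilde * (-(S * T t)) + η * C t) t := fun t =>
    (aux_hasDerivAt_mul _ (hC' t)).add (aux_hasDerivAt_mul _ (hT' t))
  have hde : deriv (fun t => Ytilde * C t + η * T t)
      = fun t => Ytilde * (-(S * T t)) + η * C t := funext fun t => (hd t).deriv
  have hd2 : ∀ t, HasDerivAt (fun t => Ytilde * (-(S * T t)) + η * C t)
      (Ytilde * (-(S * C t)) + η * (-(S * T t))) t := fun t =>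
    (aux_hasDerivAt_mul _ ((aux_hasDerivAt_mul _ (hT' t)).neg)).add (aux_hasDerivAt_mul _ (hC' t))
  have hde2 : deriv (fun t => Ytilde * (-(S * T t)) + η * C t)
      = fun t => Ytilde * (-(S * C t)) + η * (-(S * T t)) := funext fun t => (hd2 t).deriv
  refine ⟨by simp [hC0, hT0], by rw [hde]; simp [hC0, hT0], ?_, fun t => (hd t).differentiableAt,
    ?_, ?_⟩
  · intro t
    simp only [hprod, hCt, hTt]
    rw [← h1 t, ← Matrix.mul_assoc (T t), hTS, Matrix.mul_assoc]
  · rw [hde]; exact fun t => (hd2 t).differentiableAt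
  · rw [hde]
    intro t
    rw [hde2]
    beta_reduce
    have k1 : (Ytilde * (-(S * T t)) + η * C t)ᵀ * (Ytilde * (-(S * T t)) + η * C t) = S := by
      rw [hprod]
      simp only [Matrix.transpose_neg, Matrix.transpose_mul, hSt, hCt, hTt]
      calc _ = (T t * S) * (S * T t) + (C t * S) * C t := by noncomm_ring
        _ = (S * T t) * (S * T t) + (S * C t) * C t := by rw [hCS, hTS]
        _ = S * ((T t * S) * T t + C t * C t) := by noncomm_ring
        _ = S * (C t * C t + S * (T t * T t)) := by rw [hTS]; noncomm_ring
        _ = S := by rw [h1, Matrix.mul_one]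
    have k2 : (Ytilde * (-(S * T t)) + η * C t)ᵀ * (Ytilde * C t + η * T t) = 0 := by
      rw [hprod]
      simp only [Matrix.transpose_neg, Matrix.transpose_mul, hSt, hCt, hTt]
      calc _ = -((T t * S) * C t) + (C t * S) * T t := by noncomm_ring
        _ = S * (C t * T t) - S * (T t * C t) := by rw [hCS, hTS]; noncomm_ring
        _ = 0 := by rw [hCT, sub_self]
    simp only [Matrix.mul_assoc, k2]
    rw [k1]
    simp only [Matrix.mul_zero, smul_zero, add_zero, Matrix.add_mul, Matrix.mul_assoc, hCS, hTS,
      Matrix.mul_neg]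
    abel
end

section
/- Let Ỹ, Z ∈ ℝ^{n×p} satisfy ỸᵀỸ = ZᵀZ = I_p. Suppose ỸᵀZ = U·Σ·V where U, V ∈ ℝ^{p×p} are orthogonal matrices and Σ = diag(σ₁,…,σ_p) is diagonal with 0 ≤ σ_i < 1 for all i. Define η := (Z − Ỹ·ỸᵀZ)·Vᵀ·(I_p − Σ²)^{−1/2}·arccos(Σ)·Uᵀ, where arccos(Σ) := diag(arccos σ₁,…,arccos σ_p) and (I_p − Σ²)^{−1/2} := diag((1−σ₁²)^{−1/2},…,(1−σ_p²)^{−1/2}). Then Ỹᵀη = 0 and ηᵀη = U·(arccos Σ)²·Uᵀ; in particular Tr(ηᵀη) = ∑_{i=1}^p (arccos σ_i)². -/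
open Matrix

/-- Grassmann logarithm lift: given Stiefel points `Ỹ, Z` with SVD `ỸᵀZ = U Σ V`
(`Σ` diagonal with entries in `[0,1)`), the vector
`η = (Z − ỸỸᵀZ) Vᵀ (I−Σ²)^{−1/2} arccos(Σ) Uᵀ` is horizontal (`Ỹᵀη = 0`) and satisfies
`ηᵀη = U (arccos Σ)² Uᵀ`; in particular `Tr(ηᵀη) = ∑ᵢ arccos(σᵢ)²`. -/
theorem grassmann_log_horizontal {n p : ℕ}
    (Ytilde Z : Matrix (Fin n) (Fin p) ℝ)
    (U V : Matrix (Fin p) (Fin p) ℝ) (σ : Fin p → ℝ)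
    (hY : Ytildeᵀ * Ytilde = 1) (hZ : Zᵀ * Z = 1)
    (hU : Uᵀ * U = 1) (hV : Vᵀ * V = 1)
    (hσ : ∀ i, 0 ≤ σ i ∧ σ i < 1)
    (hSVD : Ytildeᵀ * Z = U * Matrix.diagonal σ * V) :
    let η : Matrix (Fin n) (Fin p) ℝ :=
      (Z - Ytilde * (Ytildeᵀ * Z)) * Vᵀ *
        Matrix.diagonal (fun i => (Real.sqrt (1 - σ i ^ 2))⁻¹) *
        Matrix.diagonal (fun i => Real.arccos (σ i)) * Uᵀ
    Ytildeᵀ * η = 0 ∧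
    ηᵀ * η = U * Matrix.diagonal (fun i => Real.arccos (σ i) ^ 2) * Uᵀ ∧
    Matrix.trace (ηᵀ * η) = ∑ i : Fin p, Real.arccos (σ i) ^ 2 := by
  intro η
  have hV' : V * Vᵀ = 1 := mul_eq_one_comm.mp hV
  have hM : (Ytildeᵀ * Z)ᵀ = Zᵀ * Ytilde := by
    rw [Matrix.transpose_mul, Matrix.transpose_transpose]
  have hYW : Ytildeᵀ * (Z - Ytilde * (Ytildeᵀ * Z)) = 0 := by
    rw [Matrix.mul_sub, ← Matrix.mul_assoc Ytildeᵀ Ytilde, hY, Matrix.one_mul, sub_self]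
  have hWW : (Z - Ytilde * (Ytildeᵀ * Z))ᵀ * (Z - Ytilde * (Ytildeᵀ * Z))
      = 1 - (Ytildeᵀ * Z)ᵀ * (Ytildeᵀ * Z) := by
    conv_lhs => rw [Matrix.transpose_sub, Matrix.sub_mul, Matrix.transpose_mul Ytilde,
      Matrix.mul_assoc _ Ytildeᵀ, hYW, Matrix.mul_zero, sub_zero, Matrix.mul_sub, hZ,
      ← Matrix.mul_assoc Zᵀ]
    rw [hM]
  have hVW : V * ((Z - Ytilde * (Ytildeᵀ * Z))ᵀ * (Z - Ytilde * (Ytildeᵀ * Z))) * Vᵀ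
      = Matrix.diagonal (fun i => 1 - σ i ^ 2) := by
    have h1 : V * ((U * Matrix.diagonal σ * V)ᵀ * (U * Matrix.diagonal σ * V)) * Vᵀ
        = (V * Vᵀ) * Matrix.diagonal σ * (Uᵀ * U) * Matrix.diagonal σ * (V * Vᵀ) := by
      simp only [Matrix.transpose_mul, Matrix.diagonal_transpose, Matrix.mul_assoc]
    rw [hWW, hSVD, Matrix.mul_sub, Matrix.sub_mul, h1, Matrix.mul_one, hV', hU]
    simp only [Matrix.mul_one, Matrix.one_mul, Matrix.diagonal_mul_diagonal]
    rw [← Matrix.diagonal_one, Matrix.diagonal_sub]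
    congr 1
    funext i
    ring
  have h2 : ηᵀ * η = U * Matrix.diagonal (fun i => Real.arccos (σ i) ^ 2) * Uᵀ := by
    have e : ηᵀ * η = U * (Matrix.diagonal (fun i => Real.arccos (σ i)) *
        Matrix.diagonal (fun i => (Real.sqrt (1 - σ i ^ 2))⁻¹) *
        (V * ((Z - Ytilde * (Ytildeᵀ * Z))ᵀ * (Z - Ytilde * (Ytildeᵀ * Z))) * Vᵀ) *
        Matrix.diagonal (fun i => (Real.sqrt (1 - σ i ^ 2))⁻¹) *
        Matrix.diagonal (fun i => Real.arccos (σ i))) * Uᵀ := by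
      simp only [η]
      generalize Z - Ytilde * (Ytildeᵀ * Z) = W
      simp only [Matrix.transpose_mul, Matrix.transpose_transpose, Matrix.diagonal_transpose,
        Matrix.mul_assoc]
    rw [e, hVW]
    simp only [Matrix.diagonal_mul_diagonal]
    congr 3
    funext i
    have hpos : 0 < 1 - σ i ^ 2 := by nlinarith [hσ i]
    have hs := Real.sq_sqrt hpos.le
    have hne : Real.sqrt (1 - σ i ^ 2) ≠ 0 := (Real.sqrt_pos.mpr hpos).ne'
    generalize Real.sqrt (1 - σ i ^ 2) = s at hs hne
    rw [← hs]
    field_simp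
  refine ⟨?_, h2, ?_⟩
  · simp only [η]
    generalize Z - Ytilde * (Ytildeᵀ * Z) = W at hYW
    simp only [← Matrix.mul_assoc]
    rw [hYW]
    simp only [Matrix.zero_mul]
  · rw [h2, Matrix.trace_mul_comm, ← Matrix.mul_assoc, hU, Matrix.one_mul, Matrix.trace_diagonal]
end

section
/- Let Ỹ, Z ∈ ℝ^{n×p} satisfy ỸᵀỸ = ZᵀZ = I_p. Suppose ỸᵀZ = U·Σ·V where U, V ∈ ℝ^{p×p} are orthogonal matrices and Σ = diag(σ₁,…,σ_p) is diagonal with 0 ≤ σ_i < 1 for all i. Define η := (Z − Ỹ·ỸᵀZ)·Vᵀ·(I_p − Σ²)^{−1/2}·arccos(Σ)·Uᵀ (entrywise functions on the diagonal as usual). Then Ỹ·csr(ηᵀη) + η·ssr(ηᵀη) = Z·Vᵀ·Uᵀ. In particular, the endpoint of the horizontal geodesic with initial velocity η differs from Z by right multiplication by the orthogonal matrix VᵀUᵀ, so it represents the same point of the Grassmann manifold as Z. -/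
open Matrix

lemma conj_series {p : ℕ} (U : Matrix (Fin p) (Fin p) ℝ) (hU : Uᵀ * U = 1)
    (d c : Fin p → ℝ) (k : ℕ → ℝ) (h : ∀ i, HasSum (fun m => k m * d i ^ m) (c i)) :
    ∑' m : ℕ, k m • (U * Matrix.diagonal d * Uᵀ) ^ m = U * Matrix.diagonal c * Uᵀ := by
  have hU' : U * Uᵀ = 1 := mul_eq_one_comm.mp hU
  have hp : ∀ m : ℕ, (U * Matrix.diagonal d * Uᵀ) ^ m
      = U * Matrix.diagonal (fun i => d i ^ m) * Uᵀ := by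
    intro m
    induction m with
    | zero => simp [hU']
    | succ m ih =>
      rw [pow_succ, ih]
      calc _ = U * Matrix.diagonal (fun i => d i ^ m) * (Uᵀ * U) * Matrix.diagonal d * Uᵀ := by
            simp only [Matrix.mul_assoc]
        _ = _ := by
            rw [hU, Matrix.mul_one, Matrix.mul_assoc U, Matrix.diagonal_mul_diagonal]
            simp only [pow_succ]
  have h1 : HasSum (fun m => fun i => k m * d i ^ m) c := Pi.hasSum.mpr h
  have h2 := ((h1.matrix_diagonal).mul_left U).mul_right Uᵀ
  rw [← h2.tsum_eq]
  congr 1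
  ext1 m
  rw [hp]
  have : Matrix.diagonal (fun i => k m * d i ^ m) = k m • Matrix.diagonal (fun i => d i ^ m) := by
    rw [← Matrix.diagonal_smul]; rfl
  rw [this, Matrix.mul_smul, Matrix.smul_mul]




/-- Grassmann logarithm: with `η = (Z − ỸỸᵀZ) Vᵀ (I−Σ²)^{−1/2} arccos(Σ) Uᵀ` built from an SVD
`ỸᵀZ = U Σ V`, the endpoint of the horizontal geodesic with initial velocity `η` is `Z Vᵀ Uᵀ`,
i.e. it differs from `Z` by right multiplication by the orthogonal matrix `VᵀUᵀ`, hence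
represents the same Grassmann point as `Z`. -/
theorem grassmann_log_endpoint {n p : ℕ}
    (Ytilde Z : Matrix (Fin n) (Fin p) ℝ)
    (U V : Matrix (Fin p) (Fin p) ℝ) (σ : Fin p → ℝ)
    (hY : Ytildeᵀ * Ytilde = 1) (hZ : Zᵀ * Z = 1)
    (hU : Uᵀ * U = 1) (hV : Vᵀ * V = 1)
    (hσ : ∀ i, 0 ≤ σ i ∧ σ i < 1)
    (hSVD : Ytildeᵀ * Z = U * Matrix.diagonal σ * V) :
    let η : Matrix (Fin n) (Fin p) ℝ :=
      (Z - Ytilde * (Ytildeᵀ * Z)) * Vᵀ *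
        Matrix.diagonal (fun i => (Real.sqrt (1 - σ i ^ 2))⁻¹) *
        Matrix.diagonal (fun i => Real.arccos (σ i)) * Uᵀ
    Ytilde * csr (ηᵀ * η) + η * ssr (ηᵀ * η) = Z * Vᵀ * Uᵀ ∧
    (Vᵀ * Uᵀ)ᵀ * (Vᵀ * Uᵀ) = 1 := by
  intro η
  have hU' : U * Uᵀ = 1 := mul_eq_one_comm.mp hU
  have hV' : V * Vᵀ = 1 := mul_eq_one_comm.mp hV
  refine ⟨?_, ?_⟩
  swap
  · rw [Matrix.transpose_mul, Matrix.transpose_transpose, Matrix.transpose_transpose,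
      Matrix.mul_assoc, ← Matrix.mul_assoc V, hV', Matrix.one_mul, hU']
  set M := Z * Vᵀ - Ytilde * U * Matrix.diagonal σ with hM
  have hMe : (Z - Ytilde * (Ytildeᵀ * Z)) * Vᵀ = M := by
    rw [hSVD, hM, Matrix.sub_mul]
    simp only [Matrix.mul_assoc, hV', Matrix.mul_one]
  have e1 : Zᵀ * Ytilde = Vᵀ * Matrix.diagonal σ * Uᵀ := by
    have := congrArg Matrix.transpose hSVD
    simpa [Matrix.transpose_mul, Matrix.mul_assoc] using this
  have hMM : Mᵀ * M = Matrix.diagonal (fun i => 1 - σ i ^ 2) := by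
    have a1 : V * Zᵀ * (Z * Vᵀ) = 1 := by
      rw [Matrix.mul_assoc, ← Matrix.mul_assoc Zᵀ, hZ, Matrix.one_mul, hV']
    have a2 : V * Zᵀ * (Ytilde * U * Matrix.diagonal σ)
        = Matrix.diagonal σ * Matrix.diagonal σ := by
      calc _ = V * (Zᵀ * Ytilde) * U * Matrix.diagonal σ := by simp only [Matrix.mul_assoc]
        _ = (V * Vᵀ) * Matrix.diagonal σ * (Uᵀ * U) * Matrix.diagonal σ := by
          rw [e1]; simp only [Matrix.mul_assoc]
        _ = _ := by rw [hV', hU, Matrix.one_mul, Matrix.mul_one]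
    have a3 : Matrix.diagonal σ * (Uᵀ * Ytildeᵀ) * (Z * Vᵀ)
        = Matrix.diagonal σ * Matrix.diagonal σ := by
      calc _ = Matrix.diagonal σ * Uᵀ * (Ytildeᵀ * Z) * Vᵀ := by simp only [Matrix.mul_assoc]
        _ = Matrix.diagonal σ * (Uᵀ * U) * Matrix.diagonal σ * (V * Vᵀ) := by
          rw [hSVD]; simp only [Matrix.mul_assoc]
        _ = _ := by rw [hV', hU, Matrix.mul_one, Matrix.mul_one]
    have a4 : Matrix.diagonal σ * (Uᵀ * Ytildeᵀ) * (Ytilde * U * Matrix.diagonal σ)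
        = Matrix.diagonal σ * Matrix.diagonal σ := by
      calc _ = Matrix.diagonal σ * (Uᵀ * (Ytildeᵀ * Ytilde) * U) * Matrix.diagonal σ := by
            simp only [Matrix.mul_assoc]
        _ = _ := by rw [hY, Matrix.mul_one, hU, Matrix.mul_one]
    have hMt : Mᵀ = V * Zᵀ - Matrix.diagonal σ * (Uᵀ * Ytildeᵀ) := by
      rw [hM]; simp [Matrix.transpose_sub, Matrix.transpose_mul]
    rw [hMt]
    nth_rewrite 1 [hM]
    rw [Matrix.sub_mul, Matrix.mul_sub, Matrix.mul_sub, a1, a2, a3, a4, sub_self, sub_zero,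
      Matrix.diagonal_mul_diagonal, ← Matrix.diagonal_one, Matrix.diagonal_sub]
    simp only [pow_two]
  have hpos : ∀ i, 0 < 1 - σ i ^ 2 := fun i => by
    obtain ⟨h0, h1⟩ := hσ i
    nlinarith
  have hs : ∀ i, 0 < Real.sqrt (1 - σ i ^ 2) := fun i => Real.sqrt_pos.mpr (hpos i)
  have ha : ∀ i, 0 < Real.arccos (σ i) := fun i => Real.arccos_pos.mpr (hσ i).2
  have hη : η = M * Matrix.diagonal (fun i => (Real.sqrt (1 - σ i ^ 2))⁻¹ * Real.arccos (σ i))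
      * Uᵀ := by
    simp only [η]
    rw [hMe, Matrix.mul_assoc M, Matrix.diagonal_mul_diagonal]
  have hηη : ηᵀ * η = U * Matrix.diagonal (fun i => Real.arccos (σ i) ^ 2) * Uᵀ := by
    rw [hη]
    simp only [Matrix.transpose_mul, Matrix.transpose_transpose, Matrix.diagonal_transpose]
    calc _ = U * (Matrix.diagonal (fun i => (Real.sqrt (1 - σ i ^ 2))⁻¹ * Real.arccos (σ i))
          * (Mᵀ * M)
          * Matrix.diagonal (fun i => (Real.sqrt (1 - σ i ^ 2))⁻¹ * Real.arccos (σ i))) * Uᵀ := by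
            simp only [Matrix.mul_assoc]
      _ = _ := by
        rw [hMM, Matrix.diagonal_mul_diagonal, Matrix.diagonal_mul_diagonal]
        congr 3
        ext i
        have h2 := Real.sq_sqrt (hpos i).le
        have h3 := (hs i).ne'
        generalize Real.sqrt (1 - σ i ^ 2) = s at *
        rw [← h2]
        field_simp
  have hc : csr (ηᵀ * η) = U * Matrix.diagonal σ * Uᵀ := by
    rw [hηη]
    unfold csr
    refine conj_series U hU _ _ (fun m => (-1 : ℝ) ^ m / (Nat.factorial (2 * m) : ℝ)) fun i => ?_
    have := Real.hasSum_cos (Real.arccos (σ i))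
    rw [Real.cos_arccos (by linarith [(hσ i).1]) (hσ i).2.le] at this
    convert this using 2 with m
    rw [pow_mul]; ring
  have hss : ssr (ηᵀ * η) = U * Matrix.diagonal
      (fun i => Real.sqrt (1 - σ i ^ 2) / Real.arccos (σ i)) * Uᵀ := by
    rw [hηη]
    unfold ssr
    refine conj_series U hU _ _
      (fun m => (-1 : ℝ) ^ m / (Nat.factorial (2 * m + 1) : ℝ)) fun i => ?_
    have := (Real.hasSum_sin (Real.arccos (σ i))).div_const (Real.arccos (σ i))
    rw [Real.sin_arccos] at this
    have h3 := (ha i).ne'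
    have hf : (fun m : ℕ => (-1 : ℝ) ^ m / (Nat.factorial (2 * m + 1) : ℝ)
        * (Real.arccos (σ i) ^ 2) ^ m) = fun m : ℕ => (-1 : ℝ) ^ m *
        Real.arccos (σ i) ^ (2 * m + 1) / (Nat.factorial (2 * m + 1) : ℝ) / Real.arccos (σ i) := by
      ext m
      rw [pow_succ (Real.arccos (σ i)) (2 * m), pow_mul]
      field_simp
    rw [← hf] at this
    exact this
  rw [hc, hss, hη]
  have hfin : M * Matrix.diagonal (fun i => (Real.sqrt (1 - σ i ^ 2))⁻¹ * Real.arccos (σ i)) * Uᵀ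
      * (U * Matrix.diagonal (fun i => Real.sqrt (1 - σ i ^ 2) / Real.arccos (σ i)) * Uᵀ)
      = M * Uᵀ := by
    calc _ = M * (Matrix.diagonal (fun i => (Real.sqrt (1 - σ i ^ 2))⁻¹ * Real.arccos (σ i))
          * (Uᵀ * U)
          * Matrix.diagonal (fun i => Real.sqrt (1 - σ i ^ 2) / Real.arccos (σ i))) * Uᵀ := by
            simp only [Matrix.mul_assoc]
      _ = M * (1 : Matrix (Fin p) (Fin p) ℝ) * Uᵀ := by
        rw [hU, Matrix.mul_one, Matrix.diagonal_mul_diagonal, ← Matrix.diagonal_one]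
        congr 3
        ext i
        have h3 := (hs i).ne'
        have h4 := (ha i).ne'
        field_simp
      _ = _ := by rw [Matrix.mul_one]
  rw [hfin, hM, Matrix.sub_mul]
  simp only [Matrix.mul_assoc]
  abel
end

section
/- Let Ỹ, Z ∈ ℝ^{n×p} satisfy ỸᵀỸ = ZᵀZ = I_p, and let η₁ ∈ ℝ^{n×p} satisfy Ỹᵀη₁ = 0. Suppose Ỹ·csr(η₁ᵀη₁) + η₁·ssr(η₁ᵀη₁) = Z·W for some W ∈ ℝ^{p×p} with WᵀW = I_p. Then csr(η₁ᵀη₁)² = ỸᵀZ·ZᵀỸ (so the symmetric matrix cos²((η₁ᵀη₁)^{1/2}) is determined by Ỹ and Z, independently of η₁ and W). -/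
open Matrix

/-- If a horizontal geodesic from `Ỹ` with initial velocity `η₁` ends at `Z W` for some
orthogonal `W`, then `csr(η₁ᵀη₁)² = ỸᵀZ ZᵀỸ`: the matrix `cos²((η₁ᵀη₁)^{1/2})` is determined
by `Ỹ` and `Z` alone. -/
theorem grassmann_cos_squared_determined {n p : ℕ}
    (Ytilde Z η₁ : Matrix (Fin n) (Fin p) ℝ) (W : Matrix (Fin p) (Fin p) ℝ)
    (hY : Ytildeᵀ * Ytilde = 1) (hZ : Zᵀ * Z = 1)
    (hhor : Ytildeᵀ * η₁ = 0) (hW : Wᵀ * W = 1)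
    (hend : Ytilde * csr (η₁ᵀ * η₁) + η₁ * ssr (η₁ᵀ * η₁) = Z * W) :
    csr (η₁ᵀ * η₁) * csr (η₁ᵀ * η₁) = Ytildeᵀ * Z * (Zᵀ * Ytilde) := by
  have hsym : (csr (η₁ᵀ * η₁))ᵀ = csr (η₁ᵀ * η₁) := by
    unfold csr
    rw [Matrix.transpose_tsum]
    simp [Matrix.transpose_smul, Matrix.transpose_pow, Matrix.transpose_mul]
  have hc : csr (η₁ᵀ * η₁) = Ytildeᵀ * Z * W := by
    have h := congrArg (fun M => Ytildeᵀ * M) hend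
    simp only [Matrix.mul_add, ← Matrix.mul_assoc, hY, hhor, Matrix.one_mul,
      Matrix.zero_mul, add_zero] at h
    exact h
  have hW' : W * Wᵀ = 1 := mul_eq_one_comm.mp hW
  calc csr (η₁ᵀ * η₁) * csr (η₁ᵀ * η₁)
      = csr (η₁ᵀ * η₁) * (csr (η₁ᵀ * η₁))ᵀ := by rw [hsym]
    _ = Ytildeᵀ * Z * (W * Wᵀ) * (Zᵀ * Ytilde) := by
        rw [hc]
        simp only [Matrix.transpose_mul, Matrix.transpose_transpose, Matrix.mul_assoc]
    _ = Ytildeᵀ * Z * (Zᵀ * Ytilde) := by rw [hW', Matrix.mul_one]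
end

section
/- Let A, E ∈ ℝ^{m×m}, C ∈ ℝ^{l×m}, D ∈ ℝ^{m×l}. Then Tr(C · L_exp(A, E) · D) = Tr(L_exp(A, D·C) · E), where L_exp denotes the Fréchet derivative of the matrix exponential. -/
open Matrix

/-- The Fréchet derivative of the matrix exponential:
`L_exp(A, E) = ∑_{i≥1} (1/i!) ∑_{a+b=i−1} A^a E A^b`. -/
noncomputable def Lexp {ι : Type*} [Fintype ι] [DecidableEq ι]
    (A E : Matrix ι ι ℝ) : Matrix ι ι ℝ :=
  ∑' i : ℕ, ((Nat.factorial (i + 1) : ℝ))⁻¹ •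
    ∑ a ∈ Finset.range (i + 1), A ^ a * E * A ^ (i - a)

section Helpers

attribute [local instance] Matrix.linftyOpNormedRing Matrix.linftyOpNormedAlgebra

theorem norm_pow_mul_le_aux {m : ℕ} (A X : Matrix (Fin m) (Fin m) ℝ) (a : ℕ) :
    ‖A ^ a * X‖ ≤ ‖A‖ ^ a * ‖X‖ := by
  induction a with
  | zero => simp
  | succ k ih =>
    rw [pow_succ', pow_succ', mul_assoc, mul_assoc]
    exact (norm_mul_le _ _).trans (mul_le_mul_of_nonneg_left ih (norm_nonneg _))

theorem norm_mul_pow_le_aux {m : ℕ} (A X : Matrix (Fin m) (Fin m) ℝ) (a : ℕ) :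
    ‖X * A ^ a‖ ≤ ‖X‖ * ‖A‖ ^ a := by
  induction a with
  | zero => simp
  | succ k ih =>
    rw [pow_succ, pow_succ, ← mul_assoc, ← mul_assoc]
    exact (norm_mul_le _ _).trans (mul_le_mul_of_nonneg_right ih (norm_nonneg _))

theorem summable_Lexp_aux {m : ℕ} (A E : Matrix (Fin m) (Fin m) ℝ) :
    Summable (fun i : ℕ => ((Nat.factorial (i + 1) : ℝ))⁻¹ •
      ∑ a ∈ Finset.range (i + 1), A ^ a * E * A ^ (i - a)) := by
  have hs : Summable (fun i : ℕ => ‖A‖ ^ i / (Nat.factorial i : ℝ) * ‖E‖) :=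
    (Real.summable_pow_div_factorial ‖A‖).mul_right _
  refine Summable.of_norm_bounded hs ?_
  intro i
  have h1 : ‖∑ a ∈ Finset.range (i + 1), A ^ a * E * A ^ (i - a)‖
      ≤ ((i + 1 : ℕ) : ℝ) * (‖A‖ ^ i * ‖E‖) := by
    refine (norm_sum_le_of_le (f := fun a => A ^ a * E * A ^ (i - a))
      (n := fun _ => ‖A‖ ^ i * ‖E‖) _ ?_).trans ?_
    · intro a ha
      have ha' : a + (i - a) = i := by have := Finset.mem_range.1 ha; omega
      refine (norm_mul_pow_le_aux A _ _).trans ?_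
      calc ‖A ^ a * E‖ * ‖A‖ ^ (i - a) ≤ (‖A‖ ^ a * ‖E‖) * ‖A‖ ^ (i - a) :=
            mul_le_mul_of_nonneg_right (norm_pow_mul_le_aux A E a) (by positivity)
        _ = ‖A‖ ^ (a + (i - a)) * ‖E‖ := by rw [pow_add]; ring
        _ = _ := by rw [ha']
    · simp
  rw [norm_smul, norm_inv, Real.norm_natCast]
  refine (mul_le_mul_of_nonneg_left h1 (by positivity)).trans (le_of_eq ?_)
  rw [Nat.factorial_succ]
  push_cast
  field_simp

end Helpers

/-- Trace identity for the Fréchet derivative of `exp`: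
`Tr(C L_exp(A,E) D) = Tr(L_exp(A, DC) E)`. -/
theorem trace_Lexp_adjoint {m l : ℕ}
    (A E : Matrix (Fin m) (Fin m) ℝ)
    (C : Matrix (Fin l) (Fin m) ℝ) (D : Matrix (Fin m) (Fin l) ℝ) :
    Matrix.trace (C * Lexp A E * D) = Matrix.trace (Lexp A (D * C) * E) := by
  let f : Matrix (Fin m) (Fin m) ℝ →+ ℝ :=
    { toFun := fun X => Matrix.trace (C * X * D)
      map_zero' := by simp
      map_add' := fun X Y => by simp [Matrix.mul_add, Matrix.add_mul] }
  let g : Matrix (Fin m) (Fin m) ℝ →+ ℝ :=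
    { toFun := fun X => Matrix.trace (X * E)
      map_zero' := by simp
      map_add' := fun X Y => by simp [Matrix.add_mul] }
  have hf : Continuous f := by
    change Continuous fun X : Matrix (Fin m) (Fin m) ℝ => Matrix.trace (C * X * D)
    fun_prop
  have hg : Continuous g := by
    change Continuous fun X : Matrix (Fin m) (Fin m) ℝ => Matrix.trace (X * E)
    fun_prop
  have h1 := (summable_Lexp_aux A E).hasSum.map f hf
  have h2 := (summable_Lexp_aux A (D * C)).hasSum.map g hg
  change f (Lexp A E) = g (Lexp A (D * C))
  refine h1.unique ?_
  change HasSum _ (g (Lexp A (D * C))) at h2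
  convert h2 using 1
  funext i
  change Matrix.trace (C * (_ : Matrix (Fin m) (Fin m) ℝ) * D) =
    Matrix.trace ((_ : Matrix (Fin m) (Fin m) ℝ) * E)
  simp only [Matrix.mul_smul, Matrix.smul_mul, Matrix.trace_smul, Matrix.mul_sum, Matrix.sum_mul,
    Matrix.trace_sum]
  congr 1
  rw [← Finset.sum_range_reflect]
  refine Finset.sum_congr rfl fun a ha => ?_
  have ha' : a ≤ i := by have := Finset.mem_range.1 ha; omega
  have e1 : i + 1 - 1 - a = i - a := by omega
  have e2 : i - (i - a) = a := by omega
  rw [e1, e2]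
  rw [Matrix.trace_mul_comm]
  rw [show D * (C * (A ^ (i - a) * E * A ^ a)) = (D * C * A ^ (i - a) * E) * A ^ a by
    simp only [Matrix.mul_assoc]]
  rw [Matrix.trace_mul_comm]
  simp only [Matrix.mul_assoc]
end

section
/- Let Ỹ ∈ ℝ^{n×p} satisfy ỸᵀỸ = I_p, let Q ∈ ℝ^{n×1} satisfy ỸᵀQ = 0 and QᵀQ = 1, and let R ∈ ℝ^{1×p} satisfy R·Rᵀ = 4π². Set η := Q·R. Then: (a) Ỹ·csr(ηᵀη) + η·ssr(ηᵀη) = Ỹ (the geodesic is closed); and (b) η·ssr((1/4)·ηᵀη) = 0, so that Ỹ·csr((1/4)ηᵀη) + (1/2)η·ssr((1/4)ηᵀη) = Ỹ·csr((1/4)ηᵀη) − (1/2)η·ssr((1/4)ηᵀη), i.e. the geodesics with initial velocities η/2 and −η/2 reach the same point at time 1. Consequently the exponential map of the Stiefel manifold is not injective on any ball of radius greater than π·√α₀ around 0 (the vector η/2 has squared metric length α₀·Tr(ηᵀη)/4 = α₀π²). -/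
open Matrix

theorem aux_pow {p : ℕ} (X : Matrix (Fin p) (Fin p) ℝ) (c : ℝ) (hc : c ≠ 0)
    (hX : X * X = (c ^ 2) • X) (m : ℕ) :
    X ^ m = (c ^ (2 * m)) • ((c ^ 2)⁻¹ • X) + (if m = 0 then 1 - (c ^ 2)⁻¹ • X else 0) := by
  have hc2 : c ^ 2 ≠ 0 := pow_ne_zero 2 hc
  have key : ∀ k : ℕ, X ^ (k + 1) = (c ^ (2 * k)) • X := by
    intro k
    induction k with
    | zero => simp
    | succ k ih =>
      rw [pow_succ, ih, smul_mul_assoc, hX, smul_smul]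
      congr 1
      ring
  cases m with
  | zero => simp
  | succ k =>
    rw [key, if_neg (Nat.succ_ne_zero k), add_zero, smul_smul]
    congr 1
    field_simp
    ring

theorem aux_csr {p : ℕ} (X : Matrix (Fin p) (Fin p) ℝ) (c : ℝ) (hc : c ≠ 0)
    (hX : X * X = (c ^ 2) • X) :
    csr X = Real.cos c • ((c ^ 2)⁻¹ • X) + (1 - (c ^ 2)⁻¹ • X) := by
  have h1 := (Real.hasSum_cos c).smul_const ((c ^ 2)⁻¹ • X)
  have h2 := hasSum_ite_eq (0 : ℕ) (1 - (c ^ 2)⁻¹ • X)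
  unfold csr
  refine HasSum.tsum_eq ?_
  convert h1.add h2 using 1
  funext m
  rw [aux_pow X c hc hX m, smul_add, smul_smul]
  congr 1
  · congr 1
    ring
  · by_cases hm : m = 0
    · subst hm; simp
    · simp [hm]

theorem aux_ssr {p : ℕ} (X : Matrix (Fin p) (Fin p) ℝ) (c : ℝ) (hc : c ≠ 0)
    (hX : X * X = (c ^ 2) • X) :
    ssr X = (Real.sin c / c) • ((c ^ 2)⁻¹ • X) + (1 - (c ^ 2)⁻¹ • X) := by
  have h1 := ((Real.hasSum_sin c).div_const c).smul_const ((c ^ 2)⁻¹ • X)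
  have h2 := hasSum_ite_eq (0 : ℕ) (1 - (c ^ 2)⁻¹ • X)
  unfold ssr
  refine HasSum.tsum_eq ?_
  convert h1.add h2 using 1
  funext m
  rw [aux_pow X c hc hX m, smul_add, smul_smul]
  congr 1
  · congr 1
    field_simp
    ring
  · by_cases hm : m = 0
    · subst hm; simp
    · simp [hm]

/-- With `η = QR`, `Qᵀ Q = 1`, `Ỹᵀ Q = 0`, `R Rᵀ = 4π²`: the horizontal geodesic
`t ↦ Ỹ csr(t²ηᵀη) + tη ssr(t²ηᵀη)` is closed at `t = 1`, and the geodesics with initial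
velocities `η/2` and `−η/2` reach the same point at time 1; hence the Stiefel exponential map
(restricted to horizontal vectors) is not injective on any ball of radius `> π√α₀`, the vector
`η/2` having squared metric length `α₀ Tr(ηᵀη)/4 = α₀ π²`. -/
theorem stiefel_exp_not_injective {n p : ℕ} (α₀ : ℝ) (hα₀ : 0 < α₀)
    (Ytilde : Matrix (Fin n) (Fin p) ℝ)
    (Q : Matrix (Fin n) (Fin 1) ℝ) (R : Matrix (Fin 1) (Fin p) ℝ)
    (hY : Ytildeᵀ * Ytilde = 1) (hQ : Qᵀ * Q = 1) (hYQ : Ytildeᵀ * Q = 0)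
    (hR : R * Rᵀ = (4 * Real.pi ^ 2) • (1 : Matrix (Fin 1) (Fin 1) ℝ)) :
    let η : Matrix (Fin n) (Fin p) ℝ := Q * R
    (Ytilde * csr (ηᵀ * η) + η * ssr (ηᵀ * η) = Ytilde) ∧
    (η * ssr ((1 / 4 : ℝ) • (ηᵀ * η)) = 0) ∧
    (Ytilde * csr ((1 / 4 : ℝ) • (ηᵀ * η)) + (1 / 2 : ℝ) • (η * ssr ((1 / 4 : ℝ) • (ηᵀ * η)))
      = Ytilde * csr ((1 / 4 : ℝ) • (ηᵀ * η)) - (1 / 2 : ℝ) • (η * ssr ((1 / 4 : ℝ) • (ηᵀ * η)))) ∧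
    (α₀ * Matrix.trace (ηᵀ * η) / 4 = α₀ * Real.pi ^ 2) ∧
    (∀ r : ℝ, Real.pi * Real.sqrt α₀ < r →
      ¬ Set.InjOn (fun v : Matrix (Fin n) (Fin p) ℝ => Ytilde * csr (vᵀ * v) + v * ssr (vᵀ * v))
        {v : Matrix (Fin n) (Fin p) ℝ | Ytildeᵀ * v = 0 ∧ α₀ * Matrix.trace (vᵀ * v) ≤ r ^ 2}) := by
  intro η
  have hpi : Real.pi ≠ 0 := Real.pi_ne_zero
  have hS : ηᵀ * η = Rᵀ * R := by
    simp only [η, Matrix.transpose_mul]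
    rw [Matrix.mul_assoc, ← Matrix.mul_assoc Qᵀ, hQ, Matrix.one_mul]
  have hηS : η * (ηᵀ * η) = (4 * Real.pi ^ 2) • η := by
    rw [hS]
    simp only [η]
    rw [Matrix.mul_assoc, ← Matrix.mul_assoc R, hR]
    simp
  have hSS : (ηᵀ * η) * (ηᵀ * η) = ((2 * Real.pi) ^ 2) • (ηᵀ * η) := by
    rw [Matrix.mul_assoc, hηS, Matrix.mul_smul]
    congr 1
    ring
  have hSS4 : ((1 / 4 : ℝ) • (ηᵀ * η)) * ((1 / 4 : ℝ) • (ηᵀ * η))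
      = (Real.pi ^ 2) • ((1 / 4 : ℝ) • (ηᵀ * η)) := by
    rw [smul_mul_assoc, mul_smul_comm, hSS, smul_smul, smul_smul, smul_smul]
    congr 1
    ring
  have hb : η * ssr ((1 / 4 : ℝ) • (ηᵀ * η)) = 0 := by
    rw [aux_ssr _ _ hpi hSS4, Real.sin_pi, zero_div, zero_smul, zero_add, Matrix.mul_sub,
      Matrix.mul_one, Matrix.mul_smul, Matrix.mul_smul, hηS, smul_smul, smul_smul]
    have : (Real.pi ^ 2)⁻¹ * (1 / 4 * (4 * Real.pi ^ 2)) = 1 := by field_simp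
    rw [← mul_assoc] at this
    simp [this, ← mul_assoc]
  have htr : Matrix.trace (ηᵀ * η) = 4 * Real.pi ^ 2 := by
    rw [hS, Matrix.trace_mul_comm, hR]
    simp
  refine ⟨?_, hb, ?_, ?_, ?_⟩
  · have h2 : 2 * Real.pi ≠ 0 := by positivity
    rw [aux_csr _ _ h2 hSS, aux_ssr _ _ h2 hSS, Real.cos_two_pi, Real.sin_two_pi, zero_div,
      zero_smul, zero_add, one_smul, add_sub_cancel, Matrix.mul_one, Matrix.mul_sub,
      Matrix.mul_one, Matrix.mul_smul, hηS, smul_smul]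
    have : ((2 * Real.pi) ^ 2)⁻¹ * (4 * Real.pi ^ 2) = 1 := by field_simp; norm_num
    rw [this]
    simp
  · rw [hb]; simp
  · rw [htr]; ring
  · intro r hr hinj
    have hYη : Ytildeᵀ * η = 0 := by
      simp only [η]
      rw [← Matrix.mul_assoc, hYQ, Matrix.zero_mul]
    have hq : ((1 / 2 : ℝ) • η)ᵀ * ((1 / 2 : ℝ) • η) = (1 / 4 : ℝ) • (ηᵀ * η) := by
      rw [Matrix.transpose_smul, Matrix.smul_mul, Matrix.mul_smul, smul_smul]
      norm_num
    have hq' : (-((1 / 2 : ℝ) • η))ᵀ * (-((1 / 2 : ℝ) • η)) = (1 / 4 : ℝ) • (ηᵀ * η) := by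
      rw [Matrix.transpose_neg, Matrix.neg_mul, Matrix.mul_neg, neg_neg, hq]
    have hlen : α₀ * Matrix.trace ((1 / 4 : ℝ) • (ηᵀ * η)) ≤ r ^ 2 := by
      rw [Matrix.trace_smul, htr, smul_eq_mul]
      have h0 : 0 ≤ Real.pi * Real.sqrt α₀ := by positivity
      have h1 : (Real.pi * Real.sqrt α₀) ^ 2 ≤ r ^ 2 := pow_le_pow_left₀ h0 hr.le 2
      rw [mul_pow, Real.sq_sqrt hα₀.le] at h1
      linarith
    have heq := @hinj ((1 / 2 : ℝ) • η) ⟨by rw [Matrix.mul_smul, hYη, smul_zero], by rw [hq]; exact hlen⟩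
      (-((1 / 2 : ℝ) • η)) ⟨by rw [Matrix.mul_neg, Matrix.mul_smul, hYη, smul_zero, neg_zero],
        by rw [hq']; exact hlen⟩
      (by
        simp only []
        rw [hq, hq', Matrix.neg_mul, Matrix.smul_mul, hb]
        simp)
    have hz : η = 0 := by
      ext i j
      have := congrFun (congrFun heq i) j
      simp only [Matrix.smul_apply, Matrix.neg_apply, smul_eq_mul] at this
      rw [Matrix.zero_apply]
      linarith
    rw [hz] at htr
    simp at htr
end

section
/- Let d₁,…,d_q > 0 with m = ∑_{i=1}^q d_i ≤ n, and let λ₁, …, λ_q be pairwise distinct nonzero real numbers. Let Λ := diag(λ₁I_{d₁}, …, λ_qI_{d_q}) ∈ ℝ^{m×m}. Let Y, Z ∈ ℝ^{n×m} satisfy YᵀY = ZᵀZ = I_m, written in column blocks Y = [Y₁, …, Y_q], Z = [Z₁, …, Z_q] with Y_i, Z_i ∈ ℝ^{n×d_i}. Then Y·Λ·Yᵀ = Z·Λ·Zᵀ if and only if there exist orthogonal matrices U_i ∈ O(d_i) with Z_i = Y_i·U_i for all i; and in that case U_i = Y_iᵀZ_i. -/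
open Matrix

/-- Flag-manifold identification (rectangular case): for `Λ = diag(λ₁ I_{d₁}, …, λ_q I_{d_q})`
with pairwise distinct nonzero `λᵢ`, and Stiefel matrices `Y, Z ∈ ℝ^{n×m}` (`m = ∑ dᵢ ≤ n`)
with column blocks `Yᵢ, Zᵢ`, one has `Y Λ Yᵀ = Z Λ Zᵀ` iff there are orthogonal `Uᵢ ∈ O(dᵢ)`
with `Zᵢ = Yᵢ Uᵢ`; and in that case `Uᵢ = Yᵢᵀ Zᵢ`. -/
theorem flag_isospectral_equiv {q n : ℕ} (d : Fin q → ℕ)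
    (hd : ∀ i : Fin q, 0 < d i)
    (hmn : Fintype.card ((i : Fin q) × Fin (d i)) ≤ n)
    (lam : Fin q → ℝ) (hlam : Function.Injective lam) (hlam0 : ∀ i, lam i ≠ 0)
    (Y Z : Matrix (Fin n) ((i : Fin q) × Fin (d i)) ℝ)
    (hY : Yᵀ * Y = 1) (hZ : Zᵀ * Z = 1) :
    let Λ : Matrix ((i : Fin q) × Fin (d i)) ((i : Fin q) × Fin (d i)) ℝ :=
      Matrix.diagonal fun a => lam a.1
    let Yb : (i : Fin q) → Matrix (Fin n) (Fin (d i)) ℝ :=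
      fun i => Y.submatrix id fun j => ⟨i, j⟩
    let Zb : (i : Fin q) → Matrix (Fin n) (Fin (d i)) ℝ :=
      fun i => Z.submatrix id fun j => ⟨i, j⟩
    (Y * Λ * Yᵀ = Z * Λ * Zᵀ ↔
      ∃ U : (i : Fin q) → Matrix (Fin (d i)) (Fin (d i)) ℝ,
        ∀ i, (U i)ᵀ * U i = 1 ∧ Zb i = Yb i * U i) ∧
    (∀ U : (i : Fin q) → Matrix (Fin (d i)) (Fin (d i)) ℝ,
      (∀ i, (U i)ᵀ * U i = 1 ∧ Zb i = Yb i * U i) →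
      ∀ i, U i = (Yb i)ᵀ * Zb i) := by
  intro Λ Yb Zb
  have key : ∀ (X : Matrix (Fin n) ((i : Fin q) × Fin (d i)) ℝ), Xᵀ * X = 1 →
      ∀ i, (X.submatrix id fun j : Fin (d i) => (⟨i, j⟩ : (i : Fin q) × Fin (d i)))ᵀ *
        (X.submatrix id fun j : Fin (d i) => (⟨i, j⟩ : (i : Fin q) × Fin (d i))) = 1 := by
    intro X hX i
    ext a b
    have h := congrFun (congrFun hX ⟨i, a⟩) ⟨i, b⟩
    simp only [Matrix.mul_apply, Matrix.transpose_apply, Matrix.submatrix_apply, id,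
      Matrix.one_apply] at h ⊢
    rw [h]
    simp
  have hYb : ∀ i, (Yb i)ᵀ * Yb i = 1 := key Y hY
  have hZb : ∀ i, (Zb i)ᵀ * Zb i = 1 := key Z hZ
  have hsum : ∀ (X : Matrix (Fin n) ((i : Fin q) × Fin (d i)) ℝ),
      X * Λ * Xᵀ = ∑ i, lam i •
        ((X.submatrix id fun j : Fin (d i) => (⟨i, j⟩ : (i : Fin q) × Fin (d i))) *
        (X.submatrix id fun j : Fin (d i) => (⟨i, j⟩ : (i : Fin q) × Fin (d i)))ᵀ) := by
    intro X
    ext a b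
    rw [Matrix.sum_apply, Matrix.mul_apply, Fintype.sum_sigma]
    refine Finset.sum_congr rfl fun i _ => ?_
    simp only [Λ, Matrix.mul_diagonal]
    simp only [Matrix.smul_apply, Matrix.mul_apply,
      Matrix.transpose_apply, Matrix.submatrix_apply, id, smul_eq_mul, Finset.mul_sum]
    refine Finset.sum_congr rfl fun j _ => ?_
    ring
  refine ⟨⟨fun h => ?_, ?_⟩, ?_⟩
  · have h1 : Y * (Λ * (Yᵀ * Z)) = Z * Λ := by
      calc Y * (Λ * (Yᵀ * Z)) = (Y * Λ * Yᵀ) * Z := by simp only [Matrix.mul_assoc]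
        _ = Z * Λ * (Zᵀ * Z) := by rw [h]; simp only [Matrix.mul_assoc]
        _ = Z * Λ := by rw [hZ, Matrix.mul_one]
    have h2 : Λ * (Yᵀ * Z) = (Yᵀ * Z) * Λ := by
      calc Λ * (Yᵀ * Z) = (Yᵀ * Y) * (Λ * (Yᵀ * Z)) := by rw [hY, Matrix.one_mul]
        _ = Yᵀ * (Z * Λ) := by rw [Matrix.mul_assoc, h1]
        _ = _ := by rw [Matrix.mul_assoc]
    have h3 : ∀ a b, a.1 ≠ b.1 → (Yᵀ * Z) a b = 0 := by
      intro a b hab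
      have h := congrFun (congrFun h2 a) b
      simp only [Λ, Matrix.diagonal_mul, Matrix.mul_diagonal] at h
      have hne : lam a.1 - lam b.1 ≠ 0 := sub_ne_zero.2 fun e => hab (hlam e)
      refine (mul_eq_zero.1 (?_ : (lam a.1 - lam b.1) * (Yᵀ * Z) a b = 0)).resolve_left hne
      linarith
    have h4 : Z = Y * (Yᵀ * Z) := by
      rw [h2, ← Matrix.mul_assoc] at h1
      ext a b
      have h := congrFun (congrFun h1 a) b
      simp only [Λ, Matrix.mul_diagonal] at h
      exact (mul_right_cancel₀ (hlam0 b.1) h).symm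
    have h5 : ∀ i, Zb i = Yb i * ((Yb i)ᵀ * Zb i) := by
      intro i
      ext a b
      have h := congrFun (congrFun h4 a) ⟨i, b⟩
      rw [Matrix.mul_apply, Fintype.sum_sigma, Finset.sum_eq_single i] at h
      · exact h
      · intro k _ hk
        refine Finset.sum_eq_zero fun j _ => ?_
        rw [h3 ⟨k, j⟩ ⟨i, b⟩ hk, mul_zero]
      · simp
    refine ⟨fun i => (Yb i)ᵀ * Zb i, fun i => ⟨?_, h5 i⟩⟩
    change ((Yb i)ᵀ * Zb i)ᵀ * ((Yb i)ᵀ * Zb i) = 1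
    rw [Matrix.transpose_mul, Matrix.transpose_transpose, Matrix.mul_assoc, ← h5 i, hZb i]
  · rintro ⟨U, hU⟩
    rw [hsum Y, hsum Z]
    refine Finset.sum_congr rfl fun i _ => ?_
    change lam i • (Yb i * (Yb i)ᵀ) = lam i • (Zb i * (Zb i)ᵀ)
    rw [(hU i).2, Matrix.transpose_mul, Matrix.mul_assoc, ← Matrix.mul_assoc (U i),
      mul_eq_one_comm.1 (hU i).1, Matrix.one_mul]
  · intro U hU i
    rw [(hU i).2, ← Matrix.mul_assoc, hYb i, Matrix.one_mul]
end

section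
/- Let α ∈ ℝ, let W ∈ ℝ^{n×m} satisfy WᵀW = I_m, and let V : ℝ → ℝ^{m×p} be a twice-differentiable curve with V(t)ᵀV(t) = I_p for all t that satisfies the α-geodesic equation (in dimensions m×p, i.e. V''(t) + V(t)·(V'(t)ᵀV'(t)) + 2(1−α)·(I_m − V(t)V(t)ᵀ)·(V'(t)V'(t)ᵀ)·V(t) = 0). Then Y(t) := W·V(t) satisfies Y(t)ᵀY(t) = I_p for all t and satisfies the α-geodesic equation in dimensions n×p. (Hence geodesics of the intersection of St(p,n) with the column span of W, in the induced metric, are geodesics of the full Stiefel manifold.) -/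
open Matrix
attribute [local instance] Matrix.normedAddCommGroup Matrix.normedSpace

/-- If `WᵀW = I_m` and `V` is an α-geodesic on the small Stiefel manifold `St(p,m)`, then
`Y(t) = W V(t)` is an α-geodesic on `St(p,n)`: geodesics of the intersection of `St(p,n)`
with the column span of `W` are geodesics of the full Stiefel manifold. -/
theorem stiefel_geodesic_in_subspace {n m p : ℕ} (α : ℝ)
    (W : Matrix (Fin n) (Fin m) ℝ) (hW : Wᵀ * W = 1)
    (V : ℝ → Matrix (Fin m) (Fin p) ℝ)
    (hSt : ∀ t : ℝ, (V t)ᵀ * V t = 1)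
    (hgeo : IsAlphaGeodesic α V) :
    (∀ t : ℝ, ((W * V t)ᵀ) * (W * V t) = 1) ∧
    IsAlphaGeodesic α (fun t => W * V t) := by
  obtain ⟨h1, h2, h3⟩ := hgeo
  have key : ∀ X : Matrix (Fin m) (Fin p) ℝ, Wᵀ * (W * X) = X := fun X => by
    rw [← Matrix.mul_assoc, hW, Matrix.one_mul]
  have hd : ∀ (F : ℝ → Matrix (Fin m) (Fin p) ℝ) (t : ℝ), DifferentiableAt ℝ F t →
      HasDerivAt (fun t => W * F t) (W * deriv F t) t := by
    intro F t hF
    let L : Matrix (Fin m) (Fin p) ℝ →ₗ[ℝ] Matrix (Fin n) (Fin p) ℝ :=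
      { toFun := fun X => W * X
        map_add' := fun X Y => Matrix.mul_add W X Y
        map_smul' := fun c X => Matrix.mul_smul W c X }
    exact (LinearMap.toContinuousLinearMap L).hasFDerivAt.comp_hasDerivAt t hF.hasDerivAt
  have e1 : deriv (fun t => W * V t) = fun t => W * deriv V t :=
    funext fun t => (hd V t (h1 t)).deriv
  have e2 : deriv (fun t => W * deriv V t) = fun t => W * deriv (deriv V) t :=
    funext fun t => (hd _ t (h2 t)).deriv
  refine ⟨fun t => ?_, fun t => (hd V t (h1 t)).differentiableAt, fun t => ?_, fun t => ?_⟩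
  · rw [Matrix.transpose_mul, Matrix.mul_assoc, key, hSt]
  · rw [e1]
    exact (hd _ t (h2 t)).differentiableAt
  · rw [e1, e2]
    have h := congrArg (fun X => W * X) (h3 t)
    simp only [Matrix.mul_add, Matrix.mul_smul, Matrix.mul_zero, Matrix.sub_mul, Matrix.mul_sub,
      Matrix.one_mul, Matrix.mul_assoc] at h
    simp only [Matrix.transpose_mul, Matrix.sub_mul, Matrix.one_mul, Matrix.mul_assoc, key]
    exact h
end
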